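/- Let H : 2^V → ℝ be a polymatroid rank function on a finite set V with |V| ≥ 2, let R := max_{P′ ∈ Π′(V)} φ(P′), and let P ∈ Π′(V) satisfy φ(P) = R. Then ĝ_R(V) = R = Σ_{C∈P} ĝ_R(C), and every C ∈ P is a separator of the Dilworth truncation ĝ_R, i.e., ĝ_R(C) + ĝ_R(V∖C) = ĝ_R(V) for every C ∈ P. -/

import Mathlib

/-- `H` is a polymatroid rank function: normalized, monotone and submodular. -/
def IsPolymatroid {V : Type*} [Fintype V] [DecidableEq V] (H : Finset V → ℝ) : Prop :=
  H ∅ = 0 ∧ (∀ X Y : Finset V, Y ⊆ X → H Y ≤ H X) ∧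
    (∀ X Y : Finset V, H (X ∪ Y) + H (X ∩ Y) ≤ H X + H Y)

/-- `f#_α`: the dual set function, `f#_α(∅) = 0` and `f#_α(X) = α − H(V) + H(X)` for `X ≠ ∅`. -/
noncomputable def fHash {V : Type*} [Fintype V] [DecidableEq V]
    (H : Finset V → ℝ) (α : ℝ) (X : Finset V) : ℝ :=
  if X = ∅ then 0 else α - H Finset.univ + H X

/-- `P` is a partition of `X`: a collection of pairwise disjoint nonempty sets with union `X`. -/
def IsPartitionOf {V : Type*} [DecidableEq V] (X : Finset V) (P : Finset (Finset V)) : Prop :=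
  (∀ C ∈ P, C.Nonempty) ∧ (∀ C ∈ P, ∀ D ∈ P, C ≠ D → Disjoint C D) ∧ P.biUnion id = X

/-- The Dilworth truncation `ĝ_α(X) = min_{P ∈ Π(X)} Σ_{C ∈ P} f#_α(C)` (with `ĝ_α(∅) = 0`,
obtained from the empty partition). -/
noncomputable def dilworth {V : Type*} [Fintype V] [DecidableEq V]
    (H : Finset V → ℝ) (α : ℝ) (X : Finset V) : ℝ :=
  sInf { s : ℝ | ∃ P : Finset (Finset V), IsPartitionOf X P ∧ s = ∑ C ∈ P, fHash H α C }

/-- `φ(P) = Σ_{C∈P} (H(V) − H(C)) / (|P| − 1)`. -/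
noncomputable def phi {V : Type*} [Fintype V] [DecidableEq V]
    (H : Finset V → ℝ) (P : Finset (Finset V)) : ℝ :=
  (∑ C ∈ P, (H Finset.univ - H C)) / ((P.card : ℝ) - 1)

theorem IsPartitionOf.subset {V : Type*} [DecidableEq V] {X : Finset V} {P : Finset (Finset V)}
    (hP : IsPartitionOf X P) {C : Finset V} (hC : C ∈ P) : C ⊆ X := by
  rw [← hP.2.2]
  exact Finset.subset_biUnion_of_mem id hC

theorem isPartitionOf_singleton {V : Type*} [DecidableEq V] {X : Finset V} (hX : X.Nonempty) :
    IsPartitionOf X {X} := by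
  refine ⟨by simpa using hX, fun C hC D hD hne => ?_, by simp⟩
  rw [Finset.mem_singleton] at hC hD
  exact absurd (hC.trans hD.symm) hne

theorem isPartitionOf_empty {V : Type*} [DecidableEq V] :
    IsPartitionOf (∅ : Finset V) ∅ := by
  simp [IsPartitionOf]

theorem IsPartitionOf.disjoint {V : Type*} [DecidableEq V] {X Y : Finset V}
    {P Q : Finset (Finset V)} (hP : IsPartitionOf X P) (hQ : IsPartitionOf Y Q)
    (hXY : Disjoint X Y) : Disjoint P Q := by
  rw [Finset.disjoint_left]
  intro C hCP hCQ
  have hC : Disjoint C C := hXY.mono (hP.subset hCP) (hQ.subset hCQ)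
  exact (hP.1 C hCP).ne_empty (disjoint_self.mp hC)

theorem IsPartitionOf.union {V : Type*} [DecidableEq V] {X Y : Finset V}
    {P Q : Finset (Finset V)} (hP : IsPartitionOf X P) (hQ : IsPartitionOf Y Q)
    (hXY : Disjoint X Y) : IsPartitionOf (X ∪ Y) (P ∪ Q) := by
  refine ⟨fun C hC => ?_, fun C hC D hD hne => ?_, ?_⟩
  · exact (Finset.mem_union.mp hC).elim (hP.1 C) (hQ.1 C)
  · rcases Finset.mem_union.mp hC with hC | hC <;> rcases Finset.mem_union.mp hD with hD | hD
    · exact hP.2.1 C hC D hD hne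
    · exact hXY.mono (hP.subset hC) (hQ.subset hD)
    · exact (hXY.mono (hP.subset hD) (hQ.subset hC)).symm
    · exact hQ.2.1 C hC D hD hne
  · rw [Finset.union_biUnion, hP.2.2, hQ.2.2]

/-- Removing one block leaves a partition of its complement. -/
theorem IsPartitionOf.erase {V : Type*} [DecidableEq V] {X : Finset V} {P : Finset (Finset V)}
    (hP : IsPartitionOf X P) {C : Finset V} (hC : C ∈ P) :
    IsPartitionOf (X \ C) (P.erase C) := by
  refine ⟨fun D hD => hP.1 D (Finset.mem_of_mem_erase hD),
    fun D hD E hE => hP.2.1 D (Finset.mem_of_mem_erase hD) E (Finset.mem_of_mem_erase hE), ?_⟩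
  have hdisj : Disjoint ((P.erase C).biUnion id) C := by
    rw [Finset.disjoint_biUnion_left]
    exact fun D hD => hP.2.1 D (Finset.mem_of_mem_erase hD) C hC (Finset.ne_of_mem_erase hD)
  have hunion : C ∪ (P.erase C).biUnion id = X := by
    rw [← hP.2.2]
    conv_rhs => rw [← Finset.insert_erase hC, Finset.biUnion_insert]
    rfl
  rw [← hunion, Finset.union_sdiff_cancel_left hdisj.symm]

section Dilworth

variable {V : Type*} [Fintype V] [DecidableEq V] (H : Finset V → ℝ) (α : ℝ)

theorem finite_partition_sums (X : Finset V) :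
    { s : ℝ | ∃ P : Finset (Finset V), IsPartitionOf X P ∧ s = ∑ C ∈ P, fHash H α C }.Finite := by
  refine (Set.finite_range fun P : Finset (Finset V) => ∑ C ∈ P, fHash H α C).subset ?_
  rintro s ⟨P, -, rfl⟩
  exact ⟨P, rfl⟩

theorem dilworth_le {X : Finset V} {P : Finset (Finset V)} (hP : IsPartitionOf X P) :
    dilworth H α X ≤ ∑ C ∈ P, fHash H α C :=
  csInf_le (finite_partition_sums H α X).bddBelow ⟨P, hP, rfl⟩

theorem dilworth_le_fHash {X : Finset V} (hX : X.Nonempty) : dilworth H α X ≤ fHash H α X := by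
  simpa using dilworth_le H α (isPartitionOf_singleton hX)

theorem exists_dilworth_eq (X : Finset V) :
    ∃ P : Finset (Finset V), IsPartitionOf X P ∧ dilworth H α X = ∑ C ∈ P, fHash H α C := by
  refine Set.Nonempty.csInf_mem ?_ (finite_partition_sums H α X)
  rcases X.eq_empty_or_nonempty with rfl | hX
  · exact ⟨_, ∅, isPartitionOf_empty, rfl⟩
  · exact ⟨_, {X}, isPartitionOf_singleton hX, rfl⟩

theorem dilworth_union_le {X Y : Finset V} (hXY : Disjoint X Y) :
    dilworth H α (X ∪ Y) ≤ dilworth H α X + dilworth H α Y := by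
  obtain ⟨P, hP, hPX⟩ := exists_dilworth_eq H α X
  obtain ⟨Q, hQ, hQY⟩ := exists_dilworth_eq H α Y
  rw [hPX, hQY, ← Finset.sum_union (hP.disjoint hQ hXY)]
  exact dilworth_le H α (hP.union hQ hXY)

theorem dilworth_biUnion_le (P : Finset (Finset V))
    (hP : ∀ C ∈ P, ∀ D ∈ P, C ≠ D → Disjoint C D) :
    dilworth H α (P.biUnion id) ≤ ∑ C ∈ P, dilworth H α C := by
  induction P using Finset.induction_on with
  | empty => simpa using dilworth_le H α (isPartitionOf_empty (V := V))
  | insert C P hC ih =>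
    rw [Finset.biUnion_insert, Finset.sum_insert hC]
    refine (dilworth_union_le H α ?_).trans (add_le_add_right (ih fun D hD E hE =>
      hP D (Finset.mem_insert_of_mem hD) E (Finset.mem_insert_of_mem hE)) _)
    rw [Finset.disjoint_biUnion_right]
    exact fun D hD => hP C (Finset.mem_insert_self C P) D (Finset.mem_insert_of_mem hD)
      fun h => hC (h ▸ hD)

theorem sum_fHash_eq {X : Finset V} {P : Finset (Finset V)} (hP : IsPartitionOf X P) :
    ∑ C ∈ P, fHash H α C = P.card * α - ∑ C ∈ P, (H Finset.univ - H C) := by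
  rw [← nsmul_eq_mul, ← Finset.sum_const, ← Finset.sum_sub_distrib]
  refine Finset.sum_congr rfl fun C hC => ?_
  rw [fHash, if_neg (hP.1 C hC).ne_empty]
  ring

end Dilworth

/-- If `P ∈ Π′(V)` attains `R = max_{P′ ∈ Π′(V)} φ(P′)`, then
`ĝ_R(V) = R = Σ_{C∈P} ĝ_R(C)` and every block of `P` is a separator of `ĝ_R`. -/
theorem stmt_15 {V : Type*} [Fintype V] [DecidableEq V] (hV : 2 ≤ Fintype.card V)
    (H : Finset V → ℝ) (hH : IsPolymatroid H) (R : ℝ)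
    (hR : IsGreatest { s : ℝ | ∃ P : Finset (Finset V),
      IsPartitionOf Finset.univ P ∧ 2 ≤ P.card ∧ s = phi H P } R)
    (P : Finset (Finset V)) (hP : IsPartitionOf Finset.univ P) (hP2 : 2 ≤ P.card)
    (hPopt : phi H P = R) :
    dilworth H R Finset.univ = R ∧
    (∑ C ∈ P, dilworth H R C) = R ∧
    ∀ C ∈ P, dilworth H R C + dilworth H R (Finset.univ \ C) = dilworth H R Finset.univ := by
  have phi_mul : ∀ Q : Finset (Finset V), 2 ≤ Q.card →
      ∑ C ∈ Q, (H Finset.univ - H C) = phi H Q * ((Q.card : ℝ) - 1) := by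
    intro Q hQ
    have hcard : (2 : ℝ) ≤ Q.card := by exact_mod_cast hQ
    rw [phi, div_mul_cancel₀ _ (by linarith)]
  have huniv : (Finset.univ : Finset V).Nonempty := by
    rw [← Finset.card_pos, Finset.card_univ]
    omega
  have hsum : ∑ C ∈ P, fHash H R C = R := by
    rw [sum_fHash_eq H R hP, phi_mul P hP2, hPopt]
    ring
  have hge : R ≤ dilworth H R Finset.univ := by
    obtain ⟨Q, hQ, hQeq⟩ := exists_dilworth_eq H R Finset.univ
    rw [hQeq]
    by_cases hcard : 2 ≤ Q.card
    · have hle : phi H Q ≤ R := hR.2 ⟨Q, hQ, hcard, rfl⟩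
      have hcard' : (2 : ℝ) ≤ Q.card := by exact_mod_cast hcard
      rw [sum_fHash_eq H R hQ, phi_mul Q hcard]
      nlinarith
    · have hpos : 0 < Q.card := by
        rw [Finset.card_pos, Finset.nonempty_iff_ne_empty]
        rintro rfl
        exact huniv.ne_empty (by simpa using hQ.2.2.symm)
      obtain ⟨D, rfl⟩ := Finset.card_eq_one.mp (by omega : Q.card = 1)
      have hD : D = Finset.univ := by simpa using hQ.2.2
      simp [hD, fHash, huniv.ne_empty]
  have heq : dilworth H R Finset.univ = R :=
    le_antisymm ((dilworth_le H R hP).trans hsum.le) hge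
  refine ⟨heq, le_antisymm ?_ ?_, fun C hC => le_antisymm ?_ ?_⟩
  · exact (Finset.sum_le_sum fun C hC => dilworth_le_fHash H R (hP.1 C hC)).trans hsum.le
  · have hle := dilworth_biUnion_le H R P hP.2.1
    rwa [hP.2.2, heq] at hle
  · refine (add_le_add (dilworth_le_fHash H R (hP.1 C hC))
      (dilworth_le H R (hP.erase hC))).trans ?_
    rw [Finset.add_sum_erase P _ hC, hsum, heq]
  · have hle := dilworth_union_le H R (Finset.disjoint_sdiff (s := C) (t := Finset.univ))
    rwa [Finset.union_sdiff_of_subset (Finset.subset_univ C)] at hle
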